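/- arXiv:2409.16390 — 2 statements merged into one kernel-verified Lean document; each statement's English description precedes it below -/
import Mathlib

section
/- Let C~ be an r-perfect S-complex over a commutative ring R (so that ΣC~ is also r-perfect). Then there are isomorphisms of R[x]-modules f̌⋆: Ȟ(ΣC~) → Ȟ(C~) and f̂⋆: Ĥ(ΣC~) → Ĥ(C~) which intertwine the long exact sequences of equivariant homology groups of ΣC~ and of C~, with the vertical map on the bar term given by multiplication by x; precisely, f̂⋆ ∘ j⋆^{ΣC~} = j⋆^{C~} ∘ f̌⋆, i⋆^{C~} ∘ f̂⋆ = (x·) ∘ i⋆^{ΣC~}, and f̌⋆ ∘ p⋆^{ΣC~} = p⋆^{C~} ∘ (x·), where x· denotes multiplication by x on 𝖱[[x⁻¹, x]. -/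
set_option maxHeartbeats 1000000

open Function

universe u

/-- A `ℤ`-graded `R`-module, presented as an `R`-module together with a family of submodules
(the homogeneous pieces). -/
structure GradedMod (R : Type u) [CommRing R] : Type (u + 1) where
  carrier : Type u
  [isAddCommGroup : AddCommGroup carrier]
  [isModule : Module R carrier]
  grading : ℤ → Submodule R carrier

attribute [instance] GradedMod.isAddCommGroup GradedMod.isModule

namespace GradedMod

variable {R : Type u} [CommRing R]

/-- `f` is homogeneous of degree `k` with respect to the gradings. -/
def IsDeg (M N : GradedMod R) (k : ℤ) (f : M.carrier →ₗ[R] N.carrier) : Prop :=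
  ∀ i : ℤ, (M.grading i).map f ≤ N.grading (i + k)

/-- The grading is an internal direct sum decomposition with finitely generated free pieces,
only finitely many of which are nonzero; i.e., the graded module is finitely generated and
free as a graded `R`-module. -/
def IsFGFree (M : GradedMod R) : Prop :=
  DirectSum.IsInternal M.grading ∧ (∀ i : ℤ, Module.Free R ↥(M.grading i)) ∧
    (∀ i : ℤ, Module.Finite R ↥(M.grading i)) ∧ {i : ℤ | M.grading i ≠ ⊥}.Finite

/-- `e` is the sign operator `ε`, acting on the degree `i` homogeneous part by `(-1)^i`. -/
def IsSign (M : GradedMod R) (e : M.carrier →ₗ[R] M.carrier) : Prop :=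
  ∀ i : ℤ, ∀ x ∈ M.grading i, e x = if Even i then x else -x

/-- The shift `M[n]`, with `M[n]_j = M_{n+j}`. -/
def shift (M : GradedMod R) (n : ℤ) : GradedMod R where
  carrier := M.carrier
  grading j := M.grading (n + j)

/-- Direct sum (product) of graded modules. -/
def prodGM (M N : GradedMod R) : GradedMod R where
  carrier := M.carrier × N.carrier
  grading j := (M.grading j).prod (N.grading j)

/-- Tensor product of graded modules, `(M ⊗ N)_k = ⊕_{i+j=k} M_i ⊗ N_j`. -/
noncomputable def tensorGM (M N : GradedMod R) : GradedMod R where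
  carrier := TensorProduct R M.carrier N.carrier
  grading k := ⨆ i : ℤ, Submodule.map₂ (TensorProduct.mk R M.carrier N.carrier)
      (M.grading i) (N.grading (k - i))

/-- Dual of a graded module: a functional has degree `-i` if it kills all `M_j`, `j ≠ i`. -/
def dualGM (M : GradedMod R) : GradedMod R where
  carrier := Module.Dual R M.carrier
  grading j := ⨅ (i : ℤ) (_ : i ≠ -j), (M.grading i).dualAnnihilator

end GradedMod

variable {R : Type u} [CommRing R]

/-- Iterated composition of a linear endomorphism. -/
def lpow {M : Type u} [AddCommGroup M] [Module R M] (f : M →ₗ[R] M) : ℕ → (M →ₗ[R] M)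
  | 0 => LinearMap.id
  | n + 1 => f ∘ₗ lpow f n

section ProdHelpers

variable {A B C D E : Type u} [AddCommGroup A] [Module R A] [AddCommGroup B] [Module R B]
  [AddCommGroup C] [Module R C] [AddCommGroup D] [Module R D] [AddCommGroup E] [Module R E]

def pj₁ : (A × B × C) →ₗ[R] A := LinearMap.fst R A (B × C)
def pj₂ : (A × B × C) →ₗ[R] B := (LinearMap.fst R B C) ∘ₗ (LinearMap.snd R A (B × C))
def pj₃ : (A × B × C) →ₗ[R] C := (LinearMap.snd R B C) ∘ₗ (LinearMap.snd R A (B × C))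

def tri (f : D →ₗ[R] A) (g : D →ₗ[R] B) (h : D →ₗ[R] C) : D →ₗ[R] A × B × C :=
  f.prod (g.prod h)

def qj₁ : (A × B × C × D) →ₗ[R] A := LinearMap.fst R A (B × C × D)
def qj₂ : (A × B × C × D) →ₗ[R] B := (LinearMap.fst R B (C × D)) ∘ₗ (LinearMap.snd R A (B × C × D))
def qj₃ : (A × B × C × D) →ₗ[R] C :=
  (LinearMap.fst R C D) ∘ₗ (LinearMap.snd R B (C × D)) ∘ₗ (LinearMap.snd R A (B × C × D))
def qj₄ : (A × B × C × D) →ₗ[R] D :=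
  (LinearMap.snd R C D) ∘ₗ (LinearMap.snd R B (C × D)) ∘ₗ (LinearMap.snd R A (B × C × D))

def quad (f : E →ₗ[R] A) (g : E →ₗ[R] B) (h : E →ₗ[R] C) (l : E →ₗ[R] D) :
    E →ₗ[R] A × B × C × D := f.prod (g.prod (h.prod l))

end ProdHelpers

/-- The data of an `S`-complex over `R`: graded modules `C` (irreducible summand) and
`𝖱` (reducible summand), together with the component maps of the differential
`d~ = [[d, 0, 0], [v, −d, δ₂], [δ₁, 0, r]]` with respect to `C~ = C ⊕ C[-1] ⊕ 𝖱`. -/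
structure SCData (R : Type u) [CommRing R] : Type (u + 1) where
  Irr : GradedMod R
  Red : GradedMod R
  d : Irr.carrier →ₗ[R] Irr.carrier
  v : Irr.carrier →ₗ[R] Irr.carrier
  δ₁ : Irr.carrier →ₗ[R] Red.carrier
  δ₂ : Red.carrier →ₗ[R] Irr.carrier
  r : Red.carrier →ₗ[R] Red.carrier

namespace SCData

/-- The five relations equivalent to `d~ ∘ d~ = 0`. -/
def Relations (S : SCData R) : Prop :=
  S.d ∘ₗ S.d = 0 ∧
  S.δ₁ ∘ₗ S.d + S.r ∘ₗ S.δ₁ = 0 ∧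
  S.d ∘ₗ S.δ₂ - S.δ₂ ∘ₗ S.r = 0 ∧
  S.d ∘ₗ S.v - S.v ∘ₗ S.d - S.δ₂ ∘ₗ S.δ₁ = 0 ∧
  S.r ∘ₗ S.r = 0

/-- The degree conditions making `d~` a degree `−1` map on `C~ = C ⊕ C[-1] ⊕ 𝖱`. -/
def Degrees (S : SCData R) : Prop :=
  S.Irr.IsDeg S.Irr (-1) S.d ∧ S.Irr.IsDeg S.Irr (-2) S.v ∧
  S.Irr.IsDeg S.Red (-1) S.δ₁ ∧ S.Red.IsDeg S.Irr (-2) S.δ₂ ∧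
  S.Red.IsDeg S.Red (-1) S.r

/-- `S` is an `S`-complex. -/
def IsSComplex (S : SCData R) : Prop :=
  S.Irr.IsFGFree ∧ S.Red.IsFGFree ∧ S.Degrees ∧ S.Relations

/-- `S` is `r`-perfect: the reducible summand is concentrated in even degrees
(which forces `r = 0` and `δ₁ ∘ v^i ∘ δ₂ = 0` for all `i ≥ 0`). -/
def RPerfect (S : SCData R) : Prop :=
  (∀ j : ℤ, Odd j → S.Red.grading j = ⊥) ∧ S.r = 0 ∧
    ∀ i : ℕ, S.δ₁ ∘ₗ lpow S.v i ∘ₗ S.δ₂ = 0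

/-- The total graded module `C~ = C ⊕ C[-1] ⊕ 𝖱`. -/
def Tot (S : SCData R) : GradedMod R where
  carrier := S.Irr.carrier × S.Irr.carrier × S.Red.carrier
  grading j := (S.Irr.grading j).prod ((S.Irr.grading (j - 1)).prod (S.Red.grading j))

/-- The total differential `d~(c, c', ρ) = (d c, v c − d c' + δ₂ ρ, δ₁ c + r ρ)`. -/
def totalDiff (S : SCData R) : S.Tot.carrier →ₗ[R] S.Tot.carrier :=
  tri (S.d ∘ₗ pj₁) (S.v ∘ₗ pj₁ - S.d ∘ₗ pj₂ + S.δ₂ ∘ₗ pj₃) (S.δ₁ ∘ₗ pj₁ + S.r ∘ₗ pj₃)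

/-- The map `χ(c, c', ρ) = (0, c, 0)`. -/
def totalChi (S : SCData R) : S.Tot.carrier →ₗ[R] S.Tot.carrier :=
  tri 0 pj₁ 0

/-- The suspension `ΣC~`: `C_Σ = C[-2] ⊕ 𝖱[-1]`, `𝖱_Σ = 𝖱`, with the differential of
Definition 2.9 of the paper. -/
def susp (S : SCData R) : SCData R where
  Irr := { carrier := S.Irr.carrier × S.Red.carrier
           grading := fun j => (S.Irr.grading (j - 2)).prod (S.Red.grading (j - 1)) }
  Red := S.Red
  d := LinearMap.prod
      (S.d ∘ₗ LinearMap.fst R S.Irr.carrier S.Red.carrier -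
        S.δ₂ ∘ₗ LinearMap.snd R S.Irr.carrier S.Red.carrier)
      (-(S.r ∘ₗ LinearMap.snd R S.Irr.carrier S.Red.carrier))
  v := LinearMap.prod (S.v ∘ₗ LinearMap.fst R S.Irr.carrier S.Red.carrier)
      (S.δ₁ ∘ₗ LinearMap.fst R S.Irr.carrier S.Red.carrier)
  δ₁ := LinearMap.snd R S.Irr.carrier S.Red.carrier
  δ₂ := LinearMap.prod (S.v ∘ₗ S.δ₂) (S.δ₁ ∘ₗ S.δ₂)
  r := S.r

/-- The negative suspension `Σ⁻¹C~`: `C_{Σ⁻¹} = C[2] ⊕ 𝖱[2]`, `𝖱_{Σ⁻¹} = 𝖱`. -/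
def negSusp (S : SCData R) : SCData R where
  Irr := { carrier := S.Irr.carrier × S.Red.carrier
           grading := fun j => (S.Irr.grading (j + 2)).prod (S.Red.grading (j + 2)) }
  Red := S.Red
  d := LinearMap.prod (S.d ∘ₗ LinearMap.fst R S.Irr.carrier S.Red.carrier)
      (S.δ₁ ∘ₗ LinearMap.fst R S.Irr.carrier S.Red.carrier +
        S.r ∘ₗ LinearMap.snd R S.Irr.carrier S.Red.carrier)
  v := LinearMap.prod (S.v ∘ₗ LinearMap.fst R S.Irr.carrier S.Red.carrier +
        S.δ₂ ∘ₗ LinearMap.snd R S.Irr.carrier S.Red.carrier) 0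
  δ₁ := S.δ₁ ∘ₗ S.v ∘ₗ LinearMap.fst R S.Irr.carrier S.Red.carrier +
        S.δ₁ ∘ₗ S.δ₂ ∘ₗ LinearMap.snd R S.Irr.carrier S.Red.carrier
  δ₂ := LinearMap.prod 0 LinearMap.id
  r := S.r

/-- `Σ^n`, the `n`-fold (negative) suspension. -/
def suspPow (S : SCData R) : ℤ → SCData R
  | Int.ofNat n => (fun X : SCData R => X.susp)^[n] S
  | Int.negSucc n => (fun X : SCData R => X.negSusp)^[n + 1] S

/-- The shifted `S`-complex `C~[n]`: gradings shifted, same differential and `χ`-map. -/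
def shiftSC (S : SCData R) (n : ℤ) : SCData R where
  Irr := S.Irr.shift n
  Red := S.Red.shift n
  d := S.d
  v := S.v
  δ₁ := S.δ₁
  δ₂ := S.δ₂
  r := S.r

end SCData

/-- A map of `S`-complexes in block form `[[λ, 0, 0], [μ, λ, Δ₂], [Δ₁, 0, ρ]]`
(equivalently, a `χ`-equivariant map `C~ → C~'`); used both for morphisms and
(with appropriate signs in the total interpretation) for homotopies. -/
structure SMap {R : Type u} [CommRing R] (S T : SCData R) : Type u where
  lam : S.Irr.carrier →ₗ[R] T.Irr.carrier
  mu : S.Irr.carrier →ₗ[R] T.Irr.carrier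
  del1 : S.Irr.carrier →ₗ[R] T.Red.carrier
  del2 : S.Red.carrier →ₗ[R] T.Irr.carrier
  rho : S.Red.carrier →ₗ[R] T.Red.carrier

namespace SMap

variable {S T U : SCData R}

/-- The component relations equivalent to `d~' λ~ = λ~ d~`. -/
def IsMor (f : SMap S T) : Prop :=
  T.d ∘ₗ f.lam - f.lam ∘ₗ S.d = 0 ∧
  f.del1 ∘ₗ S.d + f.rho ∘ₗ S.δ₁ - T.δ₁ ∘ₗ f.lam - T.r ∘ₗ f.del1 = 0 ∧
  T.d ∘ₗ f.del2 - T.δ₂ ∘ₗ f.rho + f.lam ∘ₗ S.δ₂ + f.del2 ∘ₗ S.r = 0 ∧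
  f.mu ∘ₗ S.d + T.d ∘ₗ f.mu + f.lam ∘ₗ S.v - T.v ∘ₗ f.lam + f.del2 ∘ₗ S.δ₁ - T.δ₂ ∘ₗ f.del1 = 0 ∧
  f.rho ∘ₗ S.r - T.r ∘ₗ f.rho = 0

/-- The components have the degrees of a degree `k` map of `S`-complexes. -/
def DegreesAt (f : SMap S T) (k : ℤ) : Prop :=
  S.Irr.IsDeg T.Irr k f.lam ∧ S.Irr.IsDeg T.Irr (k - 1) f.mu ∧
  S.Irr.IsDeg T.Red k f.del1 ∧ S.Red.IsDeg T.Irr (k - 1) f.del2 ∧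
  S.Red.IsDeg T.Red k f.rho

/-- Composition of morphisms of `S`-complexes, componentwise. -/
def comp (g : SMap T U) (f : SMap S T) : SMap S U where
  lam := g.lam ∘ₗ f.lam
  mu := g.lam ∘ₗ f.mu + g.mu ∘ₗ f.lam + g.del2 ∘ₗ f.del1
  del1 := g.del1 ∘ₗ f.lam + g.rho ∘ₗ f.del1
  del2 := g.lam ∘ₗ f.del2 + g.del2 ∘ₗ f.rho
  rho := g.rho ∘ₗ f.rho

/-- `K` is an `S`-chain homotopy from `f` to `g`, i.e. `d~' K~ + K~ d~ = λ~ - λ~'` where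
`K~ = [[K, 0, 0], [L, -K, M₂], [M₁, 0, J]]`, in component form. -/
def IsHtpyFrom (K f g : SMap S T) : Prop :=
  T.d ∘ₗ K.lam + K.lam ∘ₗ S.d - f.lam + g.lam = 0 ∧
  T.δ₁ ∘ₗ K.lam + T.r ∘ₗ K.del1 + K.del1 ∘ₗ S.d + K.rho ∘ₗ S.δ₁ - f.del1 + g.del1 = 0 ∧
  -(T.d ∘ₗ K.del2) + T.δ₂ ∘ₗ K.rho - K.lam ∘ₗ S.δ₂ + K.del2 ∘ₗ S.r - f.del2 + g.del2 = 0 ∧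
  T.v ∘ₗ K.lam - T.d ∘ₗ K.mu + T.δ₂ ∘ₗ K.del1 + K.mu ∘ₗ S.d - K.lam ∘ₗ S.v + K.del2 ∘ₗ S.δ₁
    - f.mu + g.mu = 0 ∧
  T.r ∘ₗ K.rho + K.rho ∘ₗ S.r - f.rho + g.rho = 0

end SMap

/-- The identity morphism. -/
def idMap (S : SCData R) : SMap S S where
  lam := LinearMap.id
  mu := 0
  del1 := 0
  del2 := 0
  rho := LinearMap.id

/-- The total map `C~ → C~'` of a morphism in block form. -/
def morTotal {S T : SCData R} (f : SMap S T) : S.Tot.carrier →ₗ[R] T.Tot.carrier :=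
  tri (f.lam ∘ₗ pj₁) (f.mu ∘ₗ pj₁ + f.lam ∘ₗ pj₂ + f.del2 ∘ₗ pj₃) (f.del1 ∘ₗ pj₁ + f.rho ∘ₗ pj₃)

/-- The total map `C~ → C~'` of a homotopy in block form. -/
def htpTotal {S T : SCData R} (K : SMap S T) : S.Tot.carrier →ₗ[R] T.Tot.carrier :=
  tri (K.lam ∘ₗ pj₁) (K.mu ∘ₗ pj₁ - K.lam ∘ₗ pj₂ + K.del2 ∘ₗ pj₃) (K.del1 ∘ₗ pj₁ + K.rho ∘ₗ pj₃)

/-- `S`-chain homotopy equivalence of `S`-complexes. -/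
def SHomotopyEquiv (S T : SCData R) : Prop :=
  ∃ (f : SMap S T) (g : SMap T S) (H₁ : SMap S S) (H₂ : SMap T T),
    f.IsMor ∧ f.DegreesAt 0 ∧ g.IsMor ∧ g.DegreesAt 0 ∧
    H₁.DegreesAt 1 ∧ SMap.IsHtpyFrom H₁ (g.comp f) (idMap S) ∧
    H₂.DegreesAt 1 ∧ SMap.IsHtpyFrom H₂ (f.comp g) (idMap T)

/-- Isomorphism of `S`-complexes: a (degree `0`) morphism with a two-sided inverse morphism. -/
def SIso (S T : SCData R) : Prop :=
  ∃ (f : SMap S T) (g : SMap T S), f.IsMor ∧ f.DegreesAt 0 ∧ g.IsMor ∧ g.DegreesAt 0 ∧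
    g.comp f = idMap S ∧ f.comp g = idMap T

/-- The suspension `Σλ~` of a morphism `λ~`, in block form. -/
def suspMap {S T : SCData R} (f : SMap S T) : SMap S.susp T.susp where
  lam := LinearMap.prod
      (f.lam ∘ₗ LinearMap.fst R S.Irr.carrier S.Red.carrier +
        f.del2 ∘ₗ LinearMap.snd R S.Irr.carrier S.Red.carrier)
      (f.rho ∘ₗ LinearMap.snd R S.Irr.carrier S.Red.carrier)
  mu := LinearMap.prod (f.mu ∘ₗ LinearMap.fst R S.Irr.carrier S.Red.carrier)
      (f.del1 ∘ₗ LinearMap.fst R S.Irr.carrier S.Red.carrier)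
  del1 := 0
  del2 := LinearMap.prod (f.mu ∘ₗ S.δ₂ + T.v ∘ₗ f.del2) (f.del1 ∘ₗ S.δ₂ + T.δ₁ ∘ₗ f.del2)
  rho := f.rho

/-- The suspension `ΣK~` of a homotopy `K~`, in block form. -/
def suspHtpy {S T : SCData R} (K : SMap S T) : SMap S.susp T.susp where
  lam := LinearMap.prod
      (K.lam ∘ₗ LinearMap.fst R S.Irr.carrier S.Red.carrier -
        K.del2 ∘ₗ LinearMap.snd R S.Irr.carrier S.Red.carrier)
      (-(K.rho ∘ₗ LinearMap.snd R S.Irr.carrier S.Red.carrier))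
  mu := LinearMap.prod (K.mu ∘ₗ LinearMap.fst R S.Irr.carrier S.Red.carrier)
      (K.del1 ∘ₗ LinearMap.fst R S.Irr.carrier S.Red.carrier)
  del1 := 0
  del2 := LinearMap.prod (T.v ∘ₗ K.del2 + K.mu ∘ₗ S.δ₂) (T.δ₁ ∘ₗ K.del2 + K.del1 ∘ₗ S.δ₂)
  rho := K.rho

/-- The sequence `τ_0 = ρ`, `τ_{i+1} = δ₁'v'^iΔ₂ + Δ₁v^iδ₂ + Σ_{j<i} δ₁'v'^j μ v^{i−1−j} δ₂`
attached to an (even degree) morphism between `r`-perfect `S`-complexes. -/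
def tauSMap {S T : SCData R} (f : SMap S T) : ℕ → (S.Red.carrier →ₗ[R] T.Red.carrier)
  | 0 => f.rho
  | i + 1 =>
      T.δ₁ ∘ₗ lpow T.v i ∘ₗ f.del2 + f.del1 ∘ₗ lpow S.v i ∘ₗ S.δ₂ +
        ∑ j ∈ Finset.range i, T.δ₁ ∘ₗ lpow T.v j ∘ₗ f.mu ∘ₗ lpow S.v (i - 1 - j) ∘ₗ S.δ₂

/-- Height `n` (for `n ≥ 0`): `τ_j = 0` for `0 ≤ j < n`. -/
def SMap.HasHeight {S T : SCData R} (f : SMap S T) (n : ℕ) : Prop :=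
  ∀ j : ℕ, j < n → tauSMap f j = 0

/-- Strong height `n`: height `n` and `τ_n` an isomorphism. -/
def SMap.StrongHeight {S T : SCData R} (f : SMap S T) (n : ℕ) : Prop :=
  f.HasHeight n ∧ Function.Bijective ⇑(tauSMap f n)

/-- The explicit model of the `n`-fold suspension `Σ^n C~` of an `r`-perfect `S`-complex:
`C_{Σ^n} = C[-2n] ⊕ ⊕_{i=0}^{n-1} 𝖱[-2i-1]` (the `m`-th factor of `Fin n → 𝖱` being
`𝖱[-2(n-1-m)-1]`), `𝖱_{Σ^n} = 𝖱`, with the components of the differential as in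
Subsection 2.4 of the paper. -/
def SCData.suspN (S : SCData R) (n : ℕ) : SCData R where
  Irr := { carrier := S.Irr.carrier × (Fin n → S.Red.carrier)
           grading := fun j => (S.Irr.grading (j - 2 * (n : ℤ))).prod
             (Submodule.pi Set.univ fun m : Fin n =>
               S.Red.grading (j - 2 * (((n - 1 - (m : ℕ) : ℕ)) : ℤ) - 1)) }
  Red := S.Red
  d := LinearMap.prod
      (S.d ∘ₗ LinearMap.fst R S.Irr.carrier (Fin n → S.Red.carrier) -
        ∑ m : Fin n, lpow S.v (m : ℕ) ∘ₗ S.δ₂ ∘ₗ LinearMap.proj m ∘ₗ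
          LinearMap.snd R S.Irr.carrier (Fin n → S.Red.carrier)) 0
  v := LinearMap.prod (S.v ∘ₗ LinearMap.fst R S.Irr.carrier (Fin n → S.Red.carrier))
      (LinearMap.pi fun m : Fin n =>
        if (m : ℕ) = 0 then S.δ₁ ∘ₗ LinearMap.fst R S.Irr.carrier (Fin n → S.Red.carrier)
        else LinearMap.proj (⟨(m : ℕ) - 1, lt_of_le_of_lt (Nat.sub_le _ _) m.isLt⟩ : Fin n) ∘ₗ
          LinearMap.snd R S.Irr.carrier (Fin n → S.Red.carrier))
  δ₁ := if h : 0 < n then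
      LinearMap.proj (⟨n - 1, Nat.sub_lt h Nat.one_pos⟩ : Fin n) ∘ₗ
        LinearMap.snd R S.Irr.carrier (Fin n → S.Red.carrier)
    else 0
  δ₂ := LinearMap.prod (lpow S.v n ∘ₗ S.δ₂) 0
  r := 0

/-- The natural morphism `ι~_n : C~ → Σ^n C~`, with `λ`-component `c ↦ (c, 0, …, 0)` and
`Δ₂`-component `θ ↦ (0, θ, 0, …, 0)`. -/
def iotaN (S : SCData R) (n : ℕ) : SMap S (S.suspN n) where
  lam := LinearMap.prod LinearMap.id 0
  mu := 0
  del1 := 0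
  del2 := LinearMap.prod 0 (LinearMap.pi fun m : Fin n => if (m : ℕ) = 0 then LinearMap.id else 0)
  rho := 0

/-- The data of a generalized height morphism between `r`-perfect `S`-complexes:
the four maps `λ, μ, Δ₁, Δ₂` and the sequence `τ_i` for `i ∈ ℤ`. -/
structure HMor {R : Type u} [CommRing R] (S T : SCData R) : Type u where
  lam : S.Irr.carrier →ₗ[R] T.Irr.carrier
  mu : S.Irr.carrier →ₗ[R] T.Irr.carrier
  del1 : S.Irr.carrier →ₗ[R] T.Red.carrier
  del2 : S.Red.carrier →ₗ[R] T.Irr.carrier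
  tau : ℤ → (S.Red.carrier →ₗ[R] T.Red.carrier)

/-- `f` is a height `n` morphism of (even) degree `k` between `r`-perfect `S`-complexes. -/
def HMor.IsHeightMor {S T : SCData R} (f : HMor S T) (n : ℤ) (k : ℤ) : Prop :=
  Even k ∧
  S.Irr.IsDeg T.Irr k f.lam ∧ S.Irr.IsDeg T.Irr (k - 1) f.mu ∧
  S.Irr.IsDeg T.Red k f.del1 ∧ S.Red.IsDeg T.Irr (k - 1) f.del2 ∧
  (∀ i : ℤ, S.Red.IsDeg T.Red (k - 2 * i) (f.tau i)) ∧
  (∀ i : ℤ, i < n → f.tau i = 0) ∧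
  (∀ i : ℕ, f.tau ((i : ℤ) + 1) =
      T.δ₁ ∘ₗ lpow T.v i ∘ₗ f.del2 + f.del1 ∘ₗ lpow S.v i ∘ₗ S.δ₂ +
        ∑ j ∈ Finset.range i, T.δ₁ ∘ₗ lpow T.v j ∘ₗ f.mu ∘ₗ lpow S.v (i - 1 - j) ∘ₗ S.δ₂) ∧
  (T.d ∘ₗ f.lam - f.lam ∘ₗ S.d -
      ∑ᶠ i : ℕ, ∑ j ∈ Finset.range (i + 1),
        lpow T.v j ∘ₗ T.δ₂ ∘ₗ f.tau (-((i : ℤ) + 1)) ∘ₗ S.δ₁ ∘ₗ lpow S.v (i - j) = 0) ∧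
  (-(T.δ₁ ∘ₗ f.lam) + f.del1 ∘ₗ S.d + ∑ᶠ i : ℕ, f.tau (-(i : ℤ)) ∘ₗ S.δ₁ ∘ₗ lpow S.v i = 0) ∧
  (f.lam ∘ₗ S.δ₂ + T.d ∘ₗ f.del2 - ∑ᶠ i : ℕ, lpow T.v i ∘ₗ T.δ₂ ∘ₗ f.tau (-(i : ℤ)) = 0) ∧
  (f.mu ∘ₗ S.d + T.d ∘ₗ f.mu + f.lam ∘ₗ S.v - T.v ∘ₗ f.lam + f.del2 ∘ₗ S.δ₁ - T.δ₂ ∘ₗ f.del1 = 0)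

/-- Composition of generalized height morphisms (Definition 2.23 of the paper). -/
noncomputable def HMor.compH {S T U : SCData R} (g : HMor T U) (f : HMor S T) : HMor S U where
  lam := g.lam ∘ₗ f.lam
    + (∑ᶠ i : ℕ, ∑ j ∈ Finset.range (i + 1),
        lpow U.v j ∘ₗ U.δ₂ ∘ₗ g.tau (-((i : ℤ) + 1)) ∘ₗ f.del1 ∘ₗ lpow S.v (i - j))
    + (∑ᶠ i : ℕ, ∑ j ∈ Finset.range (i + 1),
        lpow U.v j ∘ₗ g.del2 ∘ₗ f.tau (-((i : ℤ) + 1)) ∘ₗ S.δ₁ ∘ₗ lpow S.v (i - j))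
    + (∑ᶠ i : ℕ, ∑ j ∈ Finset.range (i + 1), ∑ l ∈ Finset.range (i - j + 1),
        lpow U.v j ∘ₗ U.δ₂ ∘ₗ g.tau (-((i : ℤ) + 2)) ∘ₗ T.δ₁ ∘ₗ lpow T.v l ∘ₗ f.mu ∘ₗ
          lpow S.v (i - j - l))
    + (∑ᶠ i : ℕ, ∑ j ∈ Finset.range (i + 1), ∑ l ∈ Finset.range (i - j + 1),
        lpow U.v j ∘ₗ g.mu ∘ₗ lpow T.v l ∘ₗ T.δ₂ ∘ₗ f.tau (-((i : ℤ) + 2)) ∘ₗ S.δ₁ ∘ₗ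
          lpow S.v (i - j - l))
  mu := g.lam ∘ₗ f.mu + g.mu ∘ₗ f.lam + g.del2 ∘ₗ f.del1
  del1 := g.del1 ∘ₗ f.lam + (∑ᶠ i : ℕ, g.tau (-(i : ℤ)) ∘ₗ f.del1 ∘ₗ lpow S.v i)
    + (∑ᶠ i : ℕ, ∑ j ∈ Finset.range (i + 1),
        g.tau (-((i : ℤ) + 1)) ∘ₗ T.δ₁ ∘ₗ lpow T.v j ∘ₗ f.mu ∘ₗ lpow S.v (i - j))
  del2 := g.lam ∘ₗ f.del2 + (∑ᶠ i : ℕ, lpow U.v i ∘ₗ g.del2 ∘ₗ f.tau (-(i : ℤ)))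
    + (∑ᶠ i : ℕ, ∑ j ∈ Finset.range (i + 1),
        lpow U.v j ∘ₗ g.mu ∘ₗ lpow T.v (i - j) ∘ₗ T.δ₂ ∘ₗ f.tau (-((i : ℤ) + 1)))
  tau := fun i => ∑ᶠ l : ℤ, g.tau (i - l) ∘ₗ f.tau l

/-- The strong height `−n` morphism `κ~_n : Σ^n C~ → C~`. -/
def kappaN (T : SCData R) (n : ℕ) : HMor (T.suspN n) T where
  lam := LinearMap.fst R T.Irr.carrier (Fin n → T.Red.carrier)
  mu := 0
  del1 := 0
  del2 := 0
  tau := fun i => if i = -(n : ℤ) then LinearMap.id else 0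

/-- An (even degree) morphism of `S`-complexes, regarded as a generalized height morphism. -/
def SMap.toHMor {S T : SCData R} (f : SMap S T) : HMor S T where
  lam := f.lam
  mu := f.mu
  del1 := f.del1
  del2 := f.del2
  tau := fun i => if 0 ≤ i then tauSMap f i.toNat else 0

/-- The height `0` morphism `λ~' : C~ → Σ^n C~'` associated to a height `−n` morphism
(Proposition 2.25 of the paper). -/
def heightNegToSusp {S T : SCData R} (f : HMor S T) (n : ℕ) : SMap S (T.suspN n) where
  lam := LinearMap.prod f.lam
    (LinearMap.pi fun m : Fin n =>
      ∑ i ∈ Finset.Icc ((m : ℕ) + 1) n, f.tau (-(i : ℤ)) ∘ₗ S.δ₁ ∘ₗ lpow S.v (i - 1 - (m : ℕ)))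
  mu := LinearMap.prod f.mu (LinearMap.pi fun m : Fin n => if (m : ℕ) = 0 then f.del1 else 0)
  del1 := 0
  del2 := LinearMap.prod f.del2 (LinearMap.pi fun m : Fin n => f.tau (-((m : ℕ) : ℤ)))
  rho := f.tau (-(n : ℤ))

/-- The morphism `ι~₁ : C~ → ΣC~`. -/
def iotaOne (S : SCData R) : SMap S S.susp where
  lam := LinearMap.prod LinearMap.id 0
  mu := 0
  del1 := 0
  del2 := LinearMap.prod 0 LinearMap.id
  rho := 0

/-- The morphism `λ~'' : ΣC~' → C~''` associated to an odd degree morphism `λ~'` together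
with the map `ν' : 𝖱' → 𝖱''` (Subsection 2.6 of the paper). -/
def lambdaSecond {S T : SCData R} (f : SMap S T) (nu : S.Red.carrier →ₗ[R] T.Red.carrier) :
    SMap S.susp T where
  lam := f.lam ∘ₗ LinearMap.fst R S.Irr.carrier S.Red.carrier +
    f.del2 ∘ₗ LinearMap.snd R S.Irr.carrier S.Red.carrier
  mu := f.mu ∘ₗ LinearMap.fst R S.Irr.carrier S.Red.carrier
  del1 := f.del1 ∘ₗ LinearMap.fst R S.Irr.carrier S.Red.carrier +
    nu ∘ₗ LinearMap.snd R S.Irr.carrier S.Red.carrier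
  del2 := f.mu ∘ₗ S.δ₂ + T.v ∘ₗ f.del2 + T.δ₂ ∘ₗ nu
  rho := 0

/-- The morphism `λ~₁ : C~ → ΣC~'` associated to height `−1` morphism data
`(λ, μ, Δ₁, Δ₂, τ₀, τ₋₁)`, in block form
`[[λ, 0, 0], [τ₋₁δ₁, 0, 0], [μ, λ, Δ₂], [Δ₁, τ₋₁δ₁, τ₀], [0, 0, τ₋₁]]`. -/
def hNegOneSusp {S T : SCData R} (lam0 mu0 : S.Irr.carrier →ₗ[R] T.Irr.carrier)
    (del10 : S.Irr.carrier →ₗ[R] T.Red.carrier) (del20 : S.Red.carrier →ₗ[R] T.Irr.carrier)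
    (tau0 taum1 : S.Red.carrier →ₗ[R] T.Red.carrier) : SMap S T.susp where
  lam := LinearMap.prod lam0 (taum1 ∘ₗ S.δ₁)
  mu := LinearMap.prod mu0 del10
  del1 := 0
  del2 := LinearMap.prod del20 tau0
  rho := taum1

/-- The mapping cone of a degree `k` morphism `λ~ : C~ → C~'`, as an `S`-complex;
its underlying graded module is `C~[-1-k] ⊕ C~'`. -/
def coneSC {S T : SCData R} (f : SMap S T) (k : ℤ) : SCData R where
  Irr := { carrier := S.Irr.carrier × T.Irr.carrier
           grading := fun j => (S.Irr.grading (j - 1 - k)).prod (T.Irr.grading j) }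
  Red := { carrier := S.Red.carrier × T.Red.carrier
           grading := fun j => (S.Red.grading (j - 1 - k)).prod (T.Red.grading j) }
  d := LinearMap.prod (-(S.d ∘ₗ LinearMap.fst R S.Irr.carrier T.Irr.carrier))
      (f.lam ∘ₗ LinearMap.fst R S.Irr.carrier T.Irr.carrier +
        T.d ∘ₗ LinearMap.snd R S.Irr.carrier T.Irr.carrier)
  v := LinearMap.prod (S.v ∘ₗ LinearMap.fst R S.Irr.carrier T.Irr.carrier)
      (f.mu ∘ₗ LinearMap.fst R S.Irr.carrier T.Irr.carrier +
        T.v ∘ₗ LinearMap.snd R S.Irr.carrier T.Irr.carrier)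
  δ₁ := LinearMap.prod (-(S.δ₁ ∘ₗ LinearMap.fst R S.Irr.carrier T.Irr.carrier))
      (f.del1 ∘ₗ LinearMap.fst R S.Irr.carrier T.Irr.carrier +
        T.δ₁ ∘ₗ LinearMap.snd R S.Irr.carrier T.Irr.carrier)
  δ₂ := LinearMap.prod (S.δ₂ ∘ₗ LinearMap.fst R S.Red.carrier T.Red.carrier)
      (f.del2 ∘ₗ LinearMap.fst R S.Red.carrier T.Red.carrier +
        T.δ₂ ∘ₗ LinearMap.snd R S.Red.carrier T.Red.carrier)
  r := LinearMap.prod (-(S.r ∘ₗ LinearMap.fst R S.Red.carrier T.Red.carrier))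
      (f.rho ∘ₗ LinearMap.fst R S.Red.carrier T.Red.carrier +
        T.r ∘ₗ LinearMap.snd R S.Red.carrier T.Red.carrier)

/-- Direct sum of `S`-complexes. -/
def sumSC (S T : SCData R) : SCData R where
  Irr := S.Irr.prodGM T.Irr
  Red := S.Red.prodGM T.Red
  d := S.d.prodMap T.d
  v := S.v.prodMap T.v
  δ₁ := S.δ₁.prodMap T.δ₁
  δ₂ := S.δ₂.prodMap T.δ₂
  r := S.r.prodMap T.r

/-- The dual `S`-complex `C~†`, defined using sign operators on the dual graded modules:
`m†(f) = −ε(f) f ∘ m`, with the roles of `δ₁` and `δ₂` interchanged. -/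
def dualSC (S : SCData R)
    (eCd : Module.Dual R S.Irr.carrier →ₗ[R] Module.Dual R S.Irr.carrier)
    (eRd : Module.Dual R S.Red.carrier →ₗ[R] Module.Dual R S.Red.carrier) : SCData R where
  Irr := S.Irr.dualGM
  Red := S.Red.dualGM
  d := -(S.d.dualMap ∘ₗ eCd)
  v := -(S.v.dualMap ∘ₗ eCd)
  δ₁ := -(S.δ₂.dualMap ∘ₗ eCd)
  δ₂ := -(S.δ₁.dualMap ∘ₗ eRd)
  r := -(S.r.dualMap ∘ₗ eRd)

/-- The rank-one graded module `R`, concentrated in degree `n`. -/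
def unitGM (R : Type u) [CommRing R] (n : ℤ) : GradedMod R where
  carrier := R
  grading j := if j = n then ⊤ else ⊥

/-- The `S`-complex `O~(1)`: `C = R` in degree `1`, `𝖱 = R` in degree `0`, `δ₁ = id`. -/
def O1 (R : Type u) [CommRing R] : SCData R where
  Irr := unitGM R 1
  Red := unitGM R 0
  d := 0
  v := 0
  δ₁ := LinearMap.id
  δ₂ := 0
  r := 0

/-- The `S`-complex `O~(-1)`: `C = R` in degree `-2`, `𝖱 = R` in degree `0`, `δ₂ = id`. -/
def Om1 (R : Type u) [CommRing R] : SCData R where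
  Irr := unitGM R (-2)
  Red := unitGM R 0
  d := 0
  v := 0
  δ₁ := 0
  δ₂ := LinearMap.id
  r := 0

/-- The `S`-complex `O~(0)`: `C = 0`, `𝖱 = R` in degree `0`, zero differential. -/
def O0 (R : Type u) [CommRing R] : SCData R where
  Irr := { carrier := ↥(⊥ : Submodule R R), grading := fun _ => ⊥ }
  Red := unitGM R 0
  d := 0
  v := 0
  δ₁ := 0
  δ₂ := 0
  r := 0

/-- The `S`-complex representation of the tensor product `C~ ⊗ C~'` of `S`-complexes
(Subsection 2.2 of the paper), where `eC`, `eR` are the sign operators of the first factor: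
`C^⊗ = (C⊗C') ⊕ (C⊗C')[-1] ⊕ (C⊗𝖱') ⊕ (𝖱⊗C')` and `𝖱^⊗ = 𝖱⊗𝖱'`. -/
noncomputable def tensorRep (S T : SCData R)
    (eC : S.Irr.carrier →ₗ[R] S.Irr.carrier) (eR : S.Red.carrier →ₗ[R] S.Red.carrier) :
    SCData R where
  Irr := (S.Irr.tensorGM T.Irr).prodGM (((S.Irr.tensorGM T.Irr).shift (-1)).prodGM
      ((S.Irr.tensorGM T.Red).prodGM (S.Red.tensorGM T.Irr)))
  Red := S.Red.tensorGM T.Red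
  d := quad
      (TensorProduct.map S.d LinearMap.id ∘ₗ qj₁ + TensorProduct.map eC T.d ∘ₗ qj₁)
      (TensorProduct.map (-(eC ∘ₗ S.v)) LinearMap.id ∘ₗ qj₁ + TensorProduct.map eC T.v ∘ₗ qj₁
        + TensorProduct.map S.d LinearMap.id ∘ₗ qj₂ - TensorProduct.map eC T.d ∘ₗ qj₂
        + TensorProduct.map eC T.δ₂ ∘ₗ qj₃
        + TensorProduct.map (-(eC ∘ₗ S.δ₂)) LinearMap.id ∘ₗ qj₄)
      (TensorProduct.map eC T.δ₁ ∘ₗ qj₁ + TensorProduct.map S.d LinearMap.id ∘ₗ qj₃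
        + TensorProduct.map eC T.r ∘ₗ qj₃)
      (TensorProduct.map S.δ₁ LinearMap.id ∘ₗ qj₁ + TensorProduct.map eR T.d ∘ₗ qj₄
        + TensorProduct.map S.r LinearMap.id ∘ₗ qj₄)
  v := quad
      (TensorProduct.map S.v LinearMap.id ∘ₗ qj₁ + TensorProduct.map S.δ₂ LinearMap.id ∘ₗ qj₄)
      (TensorProduct.map S.v LinearMap.id ∘ₗ qj₂)
      (TensorProduct.map S.v LinearMap.id ∘ₗ qj₃)
      (TensorProduct.map (eR ∘ₗ S.δ₁) LinearMap.id ∘ₗ qj₂ + TensorProduct.map LinearMap.id T.v ∘ₗ qj₄)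
  δ₁ := TensorProduct.map S.δ₁ LinearMap.id ∘ₗ qj₃ + TensorProduct.map eR T.δ₁ ∘ₗ qj₄
  δ₂ := quad 0 0 (TensorProduct.map S.δ₂ LinearMap.id) (TensorProduct.map LinearMap.id T.δ₂)
  r := TensorProduct.map S.r LinearMap.id + TensorProduct.map eR T.r

/-- Homology of an endomorphism (thought of as a differential): `ker D / im D`. -/
abbrev homologyOf {M : Type u} [AddCommGroup M] [Module R M] (D : M →ₗ[R] M) : Type u :=
  ↥(LinearMap.ker D) ⧸
    Submodule.comap (LinearMap.ker D).subtype (LinearMap.range D)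

/-- The map induced on homology by a chain map. -/
def inducedMap {M N : Type u} [AddCommGroup M] [Module R M] [AddCommGroup N] [Module R N]
    (DM : M →ₗ[R] M) (DN : N →ₗ[R] N) (f : M →ₗ[R] N) (h : DN ∘ₗ f = f ∘ₗ DM) :
    homologyOf DM →ₗ[R] homologyOf DN :=
  Submodule.mapQ _ _
    (f.restrict (p := LinearMap.ker DM) (q := LinearMap.ker DN) (fun x hx => by
      have h1 : DN (f x) = f (DM x) := by
        have h2 := LinearMap.congr_fun h x
        simpa using h2
      have hx0 : DM x = 0 := LinearMap.mem_ker.mp hx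
      simp [LinearMap.mem_ker, h1, hx0]))
    (by
      intro x hx
      simp only [Submodule.mem_comap] at hx ⊢
      obtain ⟨y, hy⟩ := hx
      refine ⟨f y, ?_⟩
      have h1 : DN (f y) = f (DM y) := by
        have h2 := LinearMap.congr_fun h y
        simpa using h2
      simp only [Submodule.coe_subtype] at hy ⊢
      rw [LinearMap.restrict_apply]
      rw [h1, hy])

/-- The degree `j` homology of a graded module with a (degree `-1`) differential. -/
abbrev gradedHomology (M : GradedMod R) (D : M.carrier →ₗ[R] M.carrier) (j : ℤ) : Type u :=
  ↥(M.grading j ⊓ LinearMap.ker D) ⧸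
    Submodule.comap (M.grading j ⊓ LinearMap.ker D).subtype ((M.grading (j + 1)).map D)

/-- The Euler characteristic `Σ_j (-1)^j rk_R M_j` of a graded module. -/
noncomputable def eulerChar (M : GradedMod R) : ℤ :=
  ∑ᶠ j : ℤ, (if Even j then (1 : ℤ) else -1) * (Module.finrank R ↥(M.grading j) : ℤ)

/-- The small equivariant complex `Ĉ = C[-1] ⊕ 𝖱[x]`, with `𝖱[x]` modelled as `ℕ →₀ 𝖱`. -/
abbrev hatC (S : SCData R) : Type u := S.Irr.carrier × (ℕ →₀ S.Red.carrier)

/-- The differential `𝔡̂(α, θxⁱ) = (dα − vⁱδ₂θ, 0)`. -/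
noncomputable def hatD (S : SCData R) : hatC S →ₗ[R] hatC S :=
  LinearMap.prod
    (S.d ∘ₗ LinearMap.fst R S.Irr.carrier (ℕ →₀ S.Red.carrier) -
      (Finsupp.lsum ℕ fun i : ℕ => lpow S.v i ∘ₗ S.δ₂) ∘ₗ
        LinearMap.snd R S.Irr.carrier (ℕ →₀ S.Red.carrier))
    0

/-- The `x`-action `x·(α, θxⁱ) = (vα, δ₁α + θx^{i+1})` on `Ĉ`. -/
noncomputable def hatX (S : SCData R) : hatC S →ₗ[R] hatC S :=
  LinearMap.prod (S.v ∘ₗ LinearMap.fst R S.Irr.carrier (ℕ →₀ S.Red.carrier))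
    (Finsupp.lsingle 0 ∘ₗ S.δ₁ ∘ₗ LinearMap.fst R S.Irr.carrier (ℕ →₀ S.Red.carrier) +
      Finsupp.lmapDomain S.Red.carrier R (fun i => i + 1) ∘ₗ
        LinearMap.snd R S.Irr.carrier (ℕ →₀ S.Red.carrier))

/-- The small equivariant complex `Č = C ⊕ 𝖱[[x⁻¹,x]/𝖱[x]`, the tail modelled as `ℕ → 𝖱`
(the `m`-th coordinate is the coefficient of `x^{-m-1}`). -/
abbrev checkC (S : SCData R) : Type u := S.Irr.carrier × (ℕ → S.Red.carrier)

/-- The differential `𝔡̌(α, θxⁱ) = (dα, Σ_{j≤-1} δ₁v^{−j−1}(α)xʲ)`. -/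
noncomputable def checkD (S : SCData R) : checkC S →ₗ[R] checkC S :=
  LinearMap.prod (S.d ∘ₗ LinearMap.fst R S.Irr.carrier (ℕ → S.Red.carrier))
    (LinearMap.pi fun m : ℕ =>
      S.δ₁ ∘ₗ lpow S.v m ∘ₗ LinearMap.fst R S.Irr.carrier (ℕ → S.Red.carrier))

/-- The `x`-action on `Č`. -/
noncomputable def checkX (S : SCData R) : checkC S →ₗ[R] checkC S :=
  LinearMap.prod
    (S.v ∘ₗ LinearMap.fst R S.Irr.carrier (ℕ → S.Red.carrier) +
      S.δ₂ ∘ₗ LinearMap.proj 0 ∘ₗ LinearMap.snd R S.Irr.carrier (ℕ → S.Red.carrier))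
    (LinearMap.pi fun m : ℕ =>
      LinearMap.proj (m + 1) ∘ₗ LinearMap.snd R S.Irr.carrier (ℕ → S.Red.carrier))

/-- The module `𝖱[[x⁻¹,x]` of Laurent series with finitely many positive powers, modelled
as (polynomial part, tail): `(ℕ →₀ 𝖱) × (ℕ → 𝖱)`. -/
abbrev barC (S : SCData R) : Type u := (ℕ →₀ S.Red.carrier) × (ℕ → S.Red.carrier)

/-- Multiplication by `x` on `𝖱[[x⁻¹,x]`. -/
noncomputable def barX (S : SCData R) : barC S →ₗ[R] barC S :=
  LinearMap.prod
    (Finsupp.lsingle 0 ∘ₗ LinearMap.proj 0 ∘ₗ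
        LinearMap.snd R (ℕ →₀ S.Red.carrier) (ℕ → S.Red.carrier) +
      Finsupp.lmapDomain S.Red.carrier R (fun i => i + 1) ∘ₗ
        LinearMap.fst R (ℕ →₀ S.Red.carrier) (ℕ → S.Red.carrier))
    (LinearMap.pi fun m : ℕ =>
      LinearMap.proj (m + 1) ∘ₗ LinearMap.snd R (ℕ →₀ S.Red.carrier) (ℕ → S.Red.carrier))

/-- The chain map `𝔦 : Ĉ → 𝖱[[x⁻¹,x]`, `(α, θ) ↦ Σ_{i≤-1} δ₁v^{−i−1}(α)xⁱ + θ`. -/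
noncomputable def mapI (S : SCData R) : hatC S →ₗ[R] barC S :=
  LinearMap.prod (LinearMap.snd R S.Irr.carrier (ℕ →₀ S.Red.carrier))
    (LinearMap.pi fun m : ℕ =>
      S.δ₁ ∘ₗ lpow S.v m ∘ₗ LinearMap.fst R S.Irr.carrier (ℕ →₀ S.Red.carrier))

/-- The chain map `𝔧 : Č → Ĉ`, `(α, ·) ↦ (−α, 0)`. -/
noncomputable def mapJ (S : SCData R) : checkC S →ₗ[R] hatC S :=
  LinearMap.prod (-(LinearMap.fst R S.Irr.carrier (ℕ → S.Red.carrier))) 0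

/-- The chain map `𝔭 : 𝖱[[x⁻¹,x] → Č`, `Σθᵢxⁱ ↦ (Σ_{i≥0} vⁱδ₂θᵢ, Σ_{i≤-1} θᵢxⁱ)`. -/
noncomputable def mapP (S : SCData R) : barC S →ₗ[R] checkC S :=
  LinearMap.prod
    ((Finsupp.lsum ℕ fun i : ℕ => lpow S.v i ∘ₗ S.δ₂) ∘ₗ
      LinearMap.fst R (ℕ →₀ S.Red.carrier) (ℕ → S.Red.carrier))
    (LinearMap.snd R (ℕ →₀ S.Red.carrier) (ℕ → S.Red.carrier))

/-- The coefficient of `xᵉ`, as a linear map `𝖱[[x⁻¹,x] → 𝖱`. -/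
noncomputable def coeffLM (S : SCData R) (e : ℤ) : barC S →ₗ[R] S.Red.carrier :=
  if 0 ≤ e then
    Finsupp.lapply e.toNat ∘ₗ LinearMap.fst R (ℕ →₀ S.Red.carrier) (ℕ → S.Red.carrier)
  else
    LinearMap.proj (-e - 1).toNat ∘ₗ LinearMap.snd R (ℕ →₀ S.Red.carrier) (ℕ → S.Red.carrier)

/-- `𝔍(C~) ⊆ 𝖱[[x⁻¹,x]`, the image of `i⋆ : Ĥ → 𝖱[[x⁻¹,x]` (equal to `𝔦(ker 𝔡̂)`). -/
noncomputable def Jmod (S : SCData R) : Submodule R (barC S) :=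
  (LinearMap.ker (hatD S)).map (mapI S)

/-- `J_i(C~) = { a₀ ∈ 𝖱 | ∃ a₀x^{-i} + a₋₁x^{-i-1} + ⋯ ∈ 𝔍(C~) }`. -/
noncomputable def Jset (S : SCData R) (i : ℤ) : Submodule R S.Red.carrier :=
  ((Jmod S) ⊓ ⨅ (e : ℤ) (_ : -i < e), LinearMap.ker (coeffLM S e)).map (coeffLM S (-i))

/-- The function `d_{C~}(i) = rk_R J_i(C~)`. -/
noncomputable def dFun (S : SCData R) (i : ℤ) : ℕ := Module.finrank R ↥(Jset S i)

section InducedMap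

variable {M N P : Type u} [AddCommGroup M] [Module R M] [AddCommGroup N] [Module R N]
  [AddCommGroup P] [Module R P]

/-- Chain maps that differ by a null-homotopic map induce the same map on homology. -/
theorem inducedMap_eq_of_homotopy {DM : M →ₗ[R] M} {DN : N →ₗ[R] N} {f g : M →ₗ[R] N}
    (hf : DN ∘ₗ f = f ∘ₗ DM) (hg : DN ∘ₗ g = g ∘ₗ DM) (K : M →ₗ[R] N)
    (hK : ∀ x, f x = g x + DN (K x) + K (DM x)) :
    inducedMap DM DN f hf = inducedMap DM DN g hg := by
  ext ⟨x, hx⟩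
  refine (Submodule.Quotient.eq _).2 ⟨K x, ?_⟩
  have hx0 : DM x = 0 := hx
  have h := hK x
  rw [hx0, map_zero, add_zero] at h
  change DN (K x) = f x - g x
  rw [h, add_sub_cancel_left]

theorem inducedMap_comp {DM : M →ₗ[R] M} {DN : N →ₗ[R] N} {DP : P →ₗ[R] P}
    {f : M →ₗ[R] N} {g : N →ₗ[R] P}
    (hf : DN ∘ₗ f = f ∘ₗ DM) (hg : DP ∘ₗ g = g ∘ₗ DN) (hgf : DP ∘ₗ (g ∘ₗ f) = (g ∘ₗ f) ∘ₗ DM) :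
    inducedMap DN DP g hg ∘ₗ inducedMap DM DN f hf = inducedMap DM DP (g ∘ₗ f) hgf := by
  ext x
  rfl

theorem comp_chainMap {DM : M →ₗ[R] M} {DN : N →ₗ[R] N} {DP : P →ₗ[R] P}
    {f : M →ₗ[R] N} {g : N →ₗ[R] P}
    (hf : DN ∘ₗ f = f ∘ₗ DM) (hg : DP ∘ₗ g = g ∘ₗ DN) : DP ∘ₗ (g ∘ₗ f) = (g ∘ₗ f) ∘ₗ DM := by
  rw [← LinearMap.comp_assoc, hg, LinearMap.comp_assoc, hf, LinearMap.comp_assoc]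

/-- Two composites of chain maps that agree up to homotopy agree on homology. -/
theorem inducedMap_comp_eq_comp {Q : Type u} [AddCommGroup Q] [Module R Q]
    {DM : M →ₗ[R] M} {DN : N →ₗ[R] N} {DP : P →ₗ[R] P} {DQ : Q →ₗ[R] Q}
    {f : M →ₗ[R] N} {g : N →ₗ[R] Q} {f' : M →ₗ[R] P} {g' : P →ₗ[R] Q}
    (hf : DN ∘ₗ f = f ∘ₗ DM) (hg : DQ ∘ₗ g = g ∘ₗ DN)
    (hf' : DP ∘ₗ f' = f' ∘ₗ DM) (hg' : DQ ∘ₗ g' = g' ∘ₗ DP) (K : M →ₗ[R] Q)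
    (hK : ∀ x, g (f x) = g' (f' x) + DQ (K x) + K (DM x)) :
    inducedMap DN DQ g hg ∘ₗ inducedMap DM DN f hf =
      inducedMap DP DQ g' hg' ∘ₗ inducedMap DM DP f' hf' := by
  rw [inducedMap_comp hf hg (comp_chainMap hf hg),
    inducedMap_comp hf' hg' (comp_chainMap hf' hg')]
  exact inducedMap_eq_of_homotopy _ _ K hK

/-- A chain map with a strict right inverse that is also a left inverse up to homotopy
induces an isomorphism on homology. -/
def homologyEquiv {DM : M →ₗ[R] M} {DN : N →ₗ[R] N} (f : M →ₗ[R] N) (g : N →ₗ[R] M)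
    (hf : DN ∘ₗ f = f ∘ₗ DM) (hg : DM ∘ₗ g = g ∘ₗ DN) (hfg : ∀ y, f (g y) = y)
    (K : M →ₗ[R] M) (hK : ∀ x, g (f x) = x + DM (K x) + K (DM x)) :
    homologyOf DM ≃ₗ[R] homologyOf DN :=
  LinearEquiv.ofLinearMap (inducedMap DM DN f hf) (inducedMap DN DM g hg)
    (by
      rw [inducedMap_comp hg hf (comp_chainMap hg hf),
        inducedMap_eq_of_homotopy (g := LinearMap.id) _ (LinearMap.comp_id DN) 0 (by simp [hfg])]
      ext x
      rfl)
    (by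
      rw [inducedMap_comp hf hg (comp_chainMap hf hg),
        inducedMap_eq_of_homotopy (g := LinearMap.id) _ (LinearMap.comp_id DM) K hK]
      ext x
      rfl)

end InducedMap

section Suspension

variable (S : SCData R)

/-- The module underlying `Ĉ(ΣC~)`, with the summands of `ΣC~` written out. -/
abbrev suspHatC : Type u := (S.Irr.carrier × S.Red.carrier) × (ℕ →₀ S.Red.carrier)

/-- The module underlying `Č(ΣC~)`, with the summands of `ΣC~` written out. -/
abbrev suspCheckC : Type u := (S.Irr.carrier × S.Red.carrier) × (ℕ → S.Red.carrier)

/-- The differential of `Ĉ(ΣC~)`. -/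
noncomputable def suspHatD : suspHatC S →ₗ[R] suspHatC S := hatD S.susp

/-- The `x`-action on `Ĉ(ΣC~)`. -/
noncomputable def suspHatX : suspHatC S →ₗ[R] suspHatC S := hatX S.susp

/-- The differential of `Č(ΣC~)`. -/
noncomputable def suspCheckD : suspCheckC S →ₗ[R] suspCheckC S := checkD S.susp

/-- The `x`-action on `Č(ΣC~)`. -/
noncomputable def suspCheckX : suspCheckC S →ₗ[R] suspCheckC S := checkX S.susp

/-- The chain map `𝔦` of `ΣC~`. -/
noncomputable def suspMapI : suspHatC S →ₗ[R] barC S := mapI S.susp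

/-- The chain map `𝔧` of `ΣC~`. -/
noncomputable def suspMapJ : suspCheckC S →ₗ[R] suspHatC S := mapJ S.susp

/-- The chain map `𝔭` of `ΣC~`. -/
noncomputable def suspMapP : barC S →ₗ[R] suspCheckC S := mapP S.susp

/-- The iterates of the `v`-map of `ΣC~`. -/
def suspLpow (n : ℕ) : (S.Irr.carrier × S.Red.carrier) →ₗ[R] S.Irr.carrier × S.Red.carrier :=
  lpow S.susp.v n

/-- The isomorphism `Ĉ(ΣC~) → Ĉ(C~)`, `((α, ρ), θ) ↦ (α, ρ + xθ)`. -/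
noncomputable def suspHat : suspHatC S →ₗ[R] hatC S where
  toFun a := (a.1.1, Finsupp.single 0 a.1.2 + Finsupp.mapDomain (fun i => i + 1) a.2)
  map_add' a b := by
    refine Prod.ext rfl ?_
    change Finsupp.single 0 (a.1.2 + b.1.2) + Finsupp.mapDomain _ (a.2 + b.2) = (_ + _) + (_ + _)
    rw [Finsupp.single_add, Finsupp.mapDomain_add, add_add_add_comm]
  map_smul' c a := by
    refine Prod.ext rfl ?_
    change Finsupp.single 0 (c • a.1.2) + Finsupp.mapDomain _ (c • a.2) = c • (_ + _)
    rw [smul_add, Finsupp.smul_single, Finsupp.mapDomain_smul]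

/-- The inverse of `suspHat`, `(α, θ) ↦ ((α, θ₀), (θ - θ₀) / x)`. -/
noncomputable def suspHatInv : hatC S →ₗ[R] suspHatC S where
  toFun a := ((a.1, a.2 0), Finsupp.comapDomain (fun i => i + 1) a.2 (add_left_injective 1).injOn)
  map_add' a b := by
    refine Prod.ext rfl ?_
    ext i
    rfl
  map_smul' c a := by
    refine Prod.ext rfl ?_
    ext i
    rfl

/-- The homotopy equivalence `Č(ΣC~) → Č(C~)`, `((α, ρ), t) ↦ (α + δ₂t₀, xt)`. -/
def suspCheck : suspCheckC S →ₗ[R] checkC S where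
  toFun a := (a.1.1 + S.δ₂ (a.2 0), fun m => a.2 (m + 1))
  map_add' a b := by
    refine Prod.ext ?_ rfl
    change (a.1.1 + b.1.1) + S.δ₂ (a.2 0 + b.2 0) = (_ + _) + (_ + _)
    rw [map_add, add_add_add_comm]
  map_smul' c a := by
    refine Prod.ext ?_ rfl
    change c • a.1.1 + S.δ₂ (c • a.2 0) = c • (_ + _)
    rw [map_smul, smul_add]

/-- The homotopy inverse of `suspCheck`, `(α, t) ↦ ((α, 0), x⁻¹t)`. -/
def suspCheckInv : checkC S →ₗ[R] suspCheckC S where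
  toFun a := ((a.1, 0), fun m => Nat.casesOn m 0 a.2)
  map_add' a b := by
    refine Prod.ext (Prod.ext rfl (add_zero 0).symm) (funext fun m => ?_)
    cases m
    · exact (add_zero 0).symm
    · rfl
  map_smul' c a := by
    refine Prod.ext (Prod.ext rfl (smul_zero c).symm) (funext fun m => ?_)
    cases m
    · exact (smul_zero c).symm
    · rfl

/-- The homotopy `((α, ρ), t) ↦ ((0, -t₀), 0)` on `Č(ΣC~)`. -/
def suspCheckHomotopy : suspCheckC S →ₗ[R] suspCheckC S where
  toFun a := ((0, -a.2 0), 0)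
  map_add' a b := by
    refine Prod.ext (Prod.ext (add_zero 0).symm ?_) (add_zero 0).symm
    exact neg_add (a.2 0) (b.2 0)
  map_smul' c a := by
    refine Prod.ext (Prod.ext (smul_zero c).symm ?_) (smul_zero c).symm
    exact (smul_neg c (a.2 0)).symm

/-- The homotopy `((α, ρ), t) ↦ (0, -t₀)` from `Č(ΣC~)` to `Ĉ(C~)`. -/
noncomputable def suspConnectingHomotopy : suspCheckC S →ₗ[R] hatC S where
  toFun a := (0, Finsupp.single 0 (-a.2 0))
  map_add' a b := by
    refine Prod.ext (add_zero 0).symm ?_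
    exact (congrArg _ (neg_add (a.2 0) (b.2 0))).trans (Finsupp.single_add _ _ _)
  map_smul' c a := by
    refine Prod.ext (smul_zero c).symm ?_
    exact (congrArg _ (smul_neg c (a.2 0)).symm).trans (Finsupp.smul_single _ _ _).symm

/-- The polynomial evaluation `Σ θᵢxⁱ ↦ Σ vⁱδ₂θᵢ`. -/
noncomputable def evalRed : (ℕ →₀ S.Red.carrier) →ₗ[R] S.Irr.carrier :=
  Finsupp.lsum ℕ fun i : ℕ => lpow S.v i ∘ₗ S.δ₂

/-- The polynomial evaluation of `evalRed` for `ΣC~`. -/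
noncomputable def suspEvalRed : (ℕ →₀ S.Red.carrier) →ₗ[R] S.Irr.carrier × S.Red.carrier :=
  evalRed S.susp

theorem evalRed_single (i : ℕ) (θ : S.Red.carrier) :
    evalRed S (Finsupp.single i θ) = lpow S.v i (S.δ₂ θ) := by
  simp [evalRed]

theorem suspLpow_succ (n : ℕ) (a : S.Irr.carrier × S.Red.carrier) :
    suspLpow S (n + 1) a = (lpow S.v (n + 1) a.1, S.δ₁ (lpow S.v n a.1)) := by
  induction n with
  | zero => rfl
  | succ n ih =>
    exact congrArg (fun b : S.Irr.carrier × S.Red.carrier => (S.v b.1, S.δ₁ b.1)) ih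

variable {S}

theorem SCData.RPerfect.delta₁_lpow_delta₂ (hS : S.RPerfect) (i : ℕ) (θ : S.Red.carrier) :
    S.δ₁ (lpow S.v i (S.δ₂ θ)) = 0 :=
  LinearMap.congr_fun (hS.2.2 i) θ

theorem lpow_comm_apply {M : Type u} [AddCommGroup M] [Module R M] (f : M →ₗ[R] M) (n : ℕ)
    (x : M) : lpow f n (f x) = f (lpow f n x) := by
  induction n with
  | zero => rfl
  | succ n ih => exact congrArg f ih

theorem suspLpow_delta₂ (hS : S.RPerfect) (i : ℕ) (θ : S.Red.carrier) :
    suspLpow S i (S.v (S.δ₂ θ), S.δ₁ (S.δ₂ θ)) = (lpow S.v (i + 1) (S.δ₂ θ), 0) := by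
  have h0 : S.δ₁ (S.δ₂ θ) = 0 := hS.delta₁_lpow_delta₂ 0 θ
  cases i with
  | zero => exact Prod.ext rfl h0
  | succ i =>
    rw [suspLpow_succ]
    rw [lpow_comm_apply, lpow_comm_apply]
    exact Prod.ext rfl (hS.delta₁_lpow_delta₂ (i + 1) θ)

theorem suspEvalRed_eq (hS : S.RPerfect) (θ : ℕ →₀ S.Red.carrier) :
    suspEvalRed S θ =
      (evalRed S (Finsupp.mapDomain (fun i => i + 1) θ), 0) := by
  induction θ using Finsupp.induction_linear with
  | zero =>
    rw [Finsupp.mapDomain_zero, map_zero, map_zero]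
    rfl
  | add f g hf hg =>
    rw [map_add, hf, hg, Finsupp.mapDomain_add, map_add]
    exact Prod.ext rfl (add_zero 0)
  | single i θ =>
    rw [Finsupp.mapDomain_single, evalRed_single]
    exact (evalRed_single S.susp i θ).trans (suspLpow_delta₂ hS i θ)

theorem SCData.IsSComplex.d_delta₂ (hS : S.IsSComplex) (hSr : S.RPerfect) (θ : S.Red.carrier) :
    S.d (S.δ₂ θ) = 0 := by
  have h := LinearMap.congr_fun hS.2.2.2.2.2.1 θ
  simpa [hSr.2.1] using h

theorem suspHat_suspHatInv (a : hatC S) : suspHat S (suspHatInv S a) = a := by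
  refine Prod.ext rfl ?_
  ext i
  change (Finsupp.single 0 (a.2 0) + Finsupp.mapDomain (fun i => i + 1)
    (Finsupp.comapDomain (fun i => i + 1) a.2 (add_left_injective 1).injOn) :
      ℕ →₀ S.Red.carrier) i = a.2 i
  rw [Finsupp.add_apply]
  cases i with
  | zero => rw [Finsupp.single_eq_same, Finsupp.mapDomain_of_notMem_range _ _ (by simp), add_zero]
  | succ i =>
    rw [Finsupp.single_eq_of_ne (by simp), zero_add]
    exact Finsupp.mapDomain_apply (add_left_injective 1) _ i

theorem suspHatInv_suspHat (a : suspHatC S) : suspHatInv S (suspHat S a) = a := by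
  refine Prod.ext (Prod.ext rfl ?_) ?_
  · change (Finsupp.single 0 a.1.2 + Finsupp.mapDomain (fun i => i + 1) a.2 :
      ℕ →₀ S.Red.carrier) 0 = a.1.2
    rw [Finsupp.add_apply, Finsupp.single_eq_same, Finsupp.mapDomain_of_notMem_range _ _ (by simp),
      add_zero]
  · ext i
    change (Finsupp.single 0 a.1.2 + Finsupp.mapDomain (fun i => i + 1) a.2 :
      ℕ →₀ S.Red.carrier) (i + 1) = a.2 i
    rw [Finsupp.add_apply, Finsupp.single_eq_of_ne (by simp), zero_add]
    exact Finsupp.mapDomain_apply (add_left_injective 1) _ i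

theorem suspHat_chainMap (hSr : S.RPerfect) :
    hatD S ∘ₗ suspHat S = suspHat S ∘ₗ suspHatD S := by
  refine LinearMap.ext fun a => ?_
  obtain ⟨⟨α, ρ⟩, θ⟩ := a
  have h2 : evalRed S (Finsupp.single 0 ρ) = S.δ₂ ρ := evalRed_single S 0 ρ
  refine Prod.ext ?_ ?_
  · change S.d α - evalRed S (Finsupp.single 0 ρ + Finsupp.mapDomain (fun i => i + 1) θ) =
      (S.d α - S.δ₂ ρ) - (suspEvalRed S θ).1
    rw [suspEvalRed_eq hSr, map_add, h2, sub_sub]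
  · change 0 = Finsupp.single 0 (-(S.r ρ) - (suspEvalRed S θ).2) +
      Finsupp.mapDomain (fun i => i + 1) (0 : ℕ →₀ S.Red.carrier)
    rw [suspEvalRed_eq hSr, hSr.2.1, Finsupp.mapDomain_zero, add_zero, LinearMap.zero_apply,
      neg_zero, sub_zero, Finsupp.single_zero]

theorem suspHatInv_chainMap (hSr : S.RPerfect) :
    suspHatD S ∘ₗ suspHatInv S = suspHatInv S ∘ₗ hatD S := by
  refine LinearMap.ext fun a => ?_
  have h := LinearMap.congr_fun (suspHat_chainMap hSr) (suspHatInv S a)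
  simp only [LinearMap.comp_apply, suspHat_suspHatInv] at h
  simp only [LinearMap.comp_apply, h, suspHatInv_suspHat]

theorem suspCheck_chainMap (hS : S.IsSComplex) (hSr : S.RPerfect) :
    checkD S ∘ₗ suspCheck S = suspCheck S ∘ₗ suspCheckD S := by
  refine LinearMap.ext fun a => ?_
  obtain ⟨⟨α, ρ⟩, t⟩ := a
  refine Prod.ext ?_ (funext fun m => ?_)
  · change S.d (α + S.δ₂ (t 0)) = (S.d α - S.δ₂ ρ) + S.δ₂ ρ
    rw [map_add, hS.d_delta₂ hSr, add_zero, sub_add_cancel]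
  · change S.δ₁ (lpow S.v m (α + S.δ₂ (t 0))) = (suspLpow S (m + 1) (α, ρ)).2
    rw [suspLpow_succ, map_add, map_add, hSr.delta₁_lpow_delta₂, add_zero]

theorem suspCheckInv_chainMap :
    suspCheckD S ∘ₗ suspCheckInv S = suspCheckInv S ∘ₗ checkD S := by
  refine LinearMap.ext fun a => ?_
  obtain ⟨α, t⟩ := a
  refine Prod.ext (Prod.ext ?_ ?_) (funext fun m => ?_)
  · change S.d α - S.δ₂ 0 = S.d α
    rw [map_zero, sub_zero]
  · change -(S.r 0) = 0
    rw [map_zero, neg_zero]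
  · cases m with
    | zero => rfl
    | succ m =>
      change (suspLpow S (m + 1) (α, (0 : S.Red.carrier))).2 = S.δ₁ (lpow S.v m α)
      rw [suspLpow_succ]

theorem suspCheck_suspCheckInv (a : checkC S) : suspCheck S (suspCheckInv S a) = a := by
  refine Prod.ext ?_ rfl
  change a.1 + S.δ₂ 0 = a.1
  rw [map_zero, add_zero]

theorem suspCheckInv_suspCheck (hSr : S.RPerfect) (a : suspCheckC S) :
    suspCheckInv S (suspCheck S a) =
      a + suspCheckD S (suspCheckHomotopy S a) + suspCheckHomotopy S (suspCheckD S a) := by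
  obtain ⟨⟨α, ρ⟩, t⟩ := a
  refine Prod.ext (Prod.ext ?_ ?_) (funext fun m => ?_)
  · change α + S.δ₂ (t 0) = α + (S.d 0 - S.δ₂ (-t 0)) + 0
    rw [map_zero, map_neg, zero_sub, neg_neg, add_zero]
  · change 0 = ρ + -(S.r (-t 0)) + -ρ
    rw [hSr.2.1, LinearMap.zero_apply, neg_zero, add_zero, add_neg_cancel]
  · cases m with
    | zero =>
      change 0 = t 0 + -t 0 + 0
      rw [add_neg_cancel, add_zero]
    | succ m =>
      change t (m + 1) = t (m + 1) + (suspLpow S (m + 1) ((0 : S.Irr.carrier), -t 0)).2 + 0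
      simp [suspLpow_succ]

theorem suspHat_hatX (a : suspHatC S) :
    suspHat S (suspHatX S a) = hatX S (suspHat S a) := by
  obtain ⟨⟨α, ρ⟩, θ⟩ := a
  rfl

theorem suspCheck_checkX (a : suspCheckC S) :
    suspCheck S (suspCheckX S a) = checkX S (suspCheck S a) := by
  obtain ⟨⟨α, ρ⟩, t⟩ := a
  refine Prod.ext ?_ rfl
  change (S.v α + S.v (S.δ₂ (t 0))) + S.δ₂ (t 1) = S.v (α + S.δ₂ (t 0)) + S.δ₂ (t 1)
  rw [map_add]

theorem suspHat_mapJ (a : suspCheckC S) :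
    suspHat S (suspMapJ S a) = mapJ S (suspCheck S a) +
      hatD S (suspConnectingHomotopy S a) + suspConnectingHomotopy S (suspCheckD S a) := by
  obtain ⟨⟨α, ρ⟩, t⟩ := a
  refine Prod.ext ?_ ?_
  · change -α = -(α + S.δ₂ (t 0)) + (S.d 0 - evalRed S (Finsupp.single 0 (-t 0))) + 0
    have h : evalRed S (Finsupp.single 0 (-t 0)) = S.δ₂ (-t 0) := evalRed_single S 0 _
    rw [h, map_zero, map_neg]
    abel
  · change Finsupp.single 0 (-ρ) + Finsupp.mapDomain (fun i => i + 1) (0 : ℕ →₀ S.Red.carrier) =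
      0 + 0 + Finsupp.single 0 (-ρ)
    rw [Finsupp.mapDomain_zero, add_zero, add_zero, zero_add]

theorem mapI_suspHat (a : suspHatC S) :
    mapI S (suspHat S a) = barX S (suspMapI S a) := by
  obtain ⟨⟨α, ρ⟩, θ⟩ := a
  refine Prod.ext rfl (funext fun m => ?_)
  change S.δ₁ (lpow S.v m α) = (suspLpow S (m + 1) (α, ρ)).2
  rw [suspLpow_succ]

theorem suspCheck_mapP (hSr : S.RPerfect) (a : barC S) :
    suspCheck S (suspMapP S a) = mapP S (barX S a) := by
  obtain ⟨θ, t⟩ := a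
  refine Prod.ext ?_ rfl
  have h : evalRed S (Finsupp.single 0 (t 0)) = S.δ₂ (t 0) := evalRed_single S 0 _
  change (suspEvalRed S θ).1 + S.δ₂ (t 0) =
    evalRed S (Finsupp.single 0 (t 0) + Finsupp.mapDomain (fun i => i + 1) θ)
  rw [suspEvalRed_eq hSr, map_add, h, add_comm]

end Suspension

/-- For an `r`-perfect `S`-complex `C~`, there are isomorphisms of
`R[x]`-modules `f̌⋆ : Ȟ(ΣC~) → Ȟ(C~)` and `f̂⋆ : Ĥ(ΣC~) → Ĥ(C~)` (i.e. `R`-linear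
isomorphisms commuting with the induced `x`-actions) which intertwine the long exact
sequences of equivariant homology groups, with the vertical map on the bar term given by
multiplication by `x`: `f̂⋆ ∘ j⋆^Σ = j⋆ ∘ f̌⋆`, `i⋆ ∘ f̂⋆ = (x·) ∘ i⋆^Σ` and
`f̌⋆ ∘ p⋆^Σ = p⋆ ∘ (x·)`. (The chain-level commutation facts, which hold for any `r`-perfect
`S`-complex, are taken as hypotheses.) -/
theorem susp_equivariant_homology {R : Type u} [CommRing R] (S : SCData R)
    (hS : S.IsSComplex) (hSr : S.RPerfect)
    (hhat : hatD S ∘ₗ hatX S = hatX S ∘ₗ hatD S)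
    (hhatS : hatD S.susp ∘ₗ hatX S.susp = hatX S.susp ∘ₗ hatD S.susp)
    (hcheck : checkD S ∘ₗ checkX S = checkX S ∘ₗ checkD S)
    (hcheckS : checkD S.susp ∘ₗ checkX S.susp = checkX S.susp ∘ₗ checkD S.susp)
    (hI : (0 : barC S →ₗ[R] barC S) ∘ₗ mapI S = mapI S ∘ₗ hatD S)
    (hIS : (0 : barC S →ₗ[R] barC S) ∘ₗ mapI S.susp = mapI S.susp ∘ₗ hatD S.susp)
    (hJ : hatD S ∘ₗ mapJ S = mapJ S ∘ₗ checkD S)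
    (hJS : hatD S.susp ∘ₗ mapJ S.susp = mapJ S.susp ∘ₗ checkD S.susp)
    (hP : checkD S ∘ₗ mapP S = mapP S ∘ₗ (0 : barC S →ₗ[R] barC S))
    (hPS : checkD S.susp ∘ₗ mapP S.susp = mapP S.susp ∘ₗ (0 : barC S →ₗ[R] barC S))
    (hxbar : (0 : barC S →ₗ[R] barC S) ∘ₗ barX S = barX S ∘ₗ (0 : barC S →ₗ[R] barC S)) :
    ∃ (Fc : homologyOf (checkD S.susp) ≃ₗ[R] homologyOf (checkD S))
      (Fh : homologyOf (hatD S.susp) ≃ₗ[R] homologyOf (hatD S)),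
      (Fh.toLinearMap ∘ₗ inducedMap (hatD S.susp) (hatD S.susp) (hatX S.susp) hhatS =
        inducedMap (hatD S) (hatD S) (hatX S) hhat ∘ₗ Fh.toLinearMap) ∧
      (Fc.toLinearMap ∘ₗ inducedMap (checkD S.susp) (checkD S.susp) (checkX S.susp) hcheckS =
        inducedMap (checkD S) (checkD S) (checkX S) hcheck ∘ₗ Fc.toLinearMap) ∧
      (Fh.toLinearMap ∘ₗ inducedMap (checkD S.susp) (hatD S.susp) (mapJ S.susp) hJS =
        inducedMap (checkD S) (hatD S) (mapJ S) hJ ∘ₗ Fc.toLinearMap) ∧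
      (inducedMap (hatD S) (0 : barC S →ₗ[R] barC S) (mapI S) hI ∘ₗ Fh.toLinearMap =
        inducedMap (0 : barC S →ₗ[R] barC S) (0 : barC S →ₗ[R] barC S) (barX S) hxbar ∘ₗ
          inducedMap (hatD S.susp) (0 : barC S →ₗ[R] barC S) (mapI S.susp) hIS) ∧
      (Fc.toLinearMap ∘ₗ inducedMap (0 : barC S →ₗ[R] barC S) (checkD S.susp) (mapP S.susp) hPS =
        inducedMap (0 : barC S →ₗ[R] barC S) (checkD S) (mapP S) hP ∘ₗ
          inducedMap (0 : barC S →ₗ[R] barC S) (0 : barC S →ₗ[R] barC S) (barX S) hxbar) := by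
  have hc := suspCheck_chainMap hS hSr
  have hh := suspHat_chainMap hSr
  refine ⟨homologyEquiv (suspCheck S) (suspCheckInv S) hc suspCheckInv_chainMap
      suspCheck_suspCheckInv (suspCheckHomotopy S) (suspCheckInv_suspCheck hSr),
    homologyEquiv (DM := suspHatD S) (suspHat S) (suspHatInv S) hh (suspHatInv_chainMap hSr)
      suspHat_suspHatInv 0 (by simp [suspHatInv_suspHat]), ?_, ?_, ?_, ?_, ?_⟩
  · exact inducedMap_comp_eq_comp (f := suspHatX S) hhatS hh hh hhat 0
      fun a => by simp [suspHat_hatX]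
  · exact inducedMap_comp_eq_comp (f := suspCheckX S) hcheckS hc hc hcheck 0
      fun a => by simp [suspCheck_checkX]
  · exact inducedMap_comp_eq_comp (f := suspMapJ S) hJS hh hc hJ (suspConnectingHomotopy S)
      suspHat_mapJ
  · exact inducedMap_comp_eq_comp (f' := suspMapI S) hh hI hIS hxbar 0
      fun a => by simp [mapI_suspHat]
  · exact inducedMap_comp_eq_comp (f := suspMapP S) hPS hc hxbar hP 0
      fun a => by simp [suspCheck_mapP hSr]
end

section
/- Let C~′ and C~″ be r-perfect S-complexes over a commutative ring R (so r′ = r″ = 0 and δ₁′δ₂′ = 0), and let λ~′: C~′ → C~″ be a morphism of odd degree with components (λ′, μ′, Δ₁′, Δ₂′, ρ′); since the reducible summands are concentrated in even degrees and λ~′ has odd degree, ρ′ = 0, δ₁″Δ₂′ = 0 and Δ₁′δ₂′ = 0. Let ν′: 𝖱′ → 𝖱″ be an arbitrary R-linear map of degree one less than the degree of λ~′. Then the block matrix λ~″ = [[λ′, Δ₂′, 0, 0, 0], [μ′, 0, λ′, Δ₂′, μ′δ₂′ + v″Δ₂′ + δ₂″ν′], [Δ₁′, ν′, 0, 0, 0]],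 taken with respect to the decomposition ΣC~′ = (C′[-2] ⊕ 𝖱′[-1]) ⊕ (C′[-3] ⊕ 𝖱′[-2]) ⊕ 𝖱′ and C~″ = C″ ⊕ C″[-1] ⊕ 𝖱″, defines a morphism of S-complexes λ~″: ΣC~′ → C~″, and it satisfies λ~″ ∘ ι~₁ = λ~′. -/
set_option maxHeartbeats 1000000

open Function

universe u

variable {R : Type u} [CommRing R]

/-- Homogeneous maps send homogeneous elements to homogeneous elements of the shifted degree. -/
theorem GradedMod.IsDeg.apply_mem {R : Type u} [CommRing R] {M N : GradedMod R} {k : ℤ}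
    {g : M.carrier →ₗ[R] N.carrier} (hg : M.IsDeg N k g) {i j : ℤ} (hij : i + k = j)
    {x : M.carrier} (hx : x ∈ M.grading i) : g x ∈ N.grading j :=
  hij ▸ hg i (Submodule.mem_map_of_mem hx)

theorem lambdaSecond_isMor_of_relations {R : Type u} [CommRing R] {S T : SCData R}
    (hS : S.Relations) (hSr : S.r = 0) (hT : T.Relations) (hTr : T.r = 0)
    {f : SMap S T} (hf : f.IsMor) (hrho : f.rho = 0) (hd2 : T.δ₁ ∘ₗ f.del2 = 0)
    (hd1 : f.del1 ∘ₗ S.δ₂ = 0) (nu : S.Red.carrier →ₗ[R] T.Red.carrier) :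
    (lambdaSecond f nu).IsMor := by
  obtain ⟨-, -, hSdδ, -, -⟩ := hS
  obtain ⟨-, -, hTdδ, hTdv, -⟩ := hT
  obtain ⟨hlam, hdel1, hdel2, hmu, -⟩ := hf
  simp only [hSr, hTr, hrho, LinearMap.comp_zero, LinearMap.zero_comp, add_zero, sub_zero]
    at hSdδ hTdδ hdel1 hdel2
  replace hSdδ (θ) : S.d (S.δ₂ θ) = 0 := LinearMap.congr_fun hSdδ θ
  replace hTdδ (θ) : T.d (T.δ₂ θ) = 0 := LinearMap.congr_fun hTdδ θ
  replace hd1 (θ) : f.del1 (S.δ₂ θ) = 0 := LinearMap.congr_fun hd1 θ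
  replace hd2 (θ) : T.δ₁ (f.del2 θ) = 0 := LinearMap.congr_fun hd2 θ
  replace hTdv (c) : T.d (T.v c) - T.v (T.d c) - T.δ₂ (T.δ₁ c) = 0 := LinearMap.congr_fun hTdv c
  replace hlam (c) : T.d (f.lam c) - f.lam (S.d c) = 0 := LinearMap.congr_fun hlam c
  replace hdel1 (c) : f.del1 (S.d c) - T.δ₁ (f.lam c) = 0 := LinearMap.congr_fun hdel1 c
  replace hdel2 (θ) : T.d (f.del2 θ) + f.lam (S.δ₂ θ) = 0 := LinearMap.congr_fun hdel2 θ
  replace hmu (c) : f.mu (S.d c) + T.d (f.mu c) + f.lam (S.v c) - T.v (f.lam c)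
      + f.del2 (S.δ₁ c) - T.δ₂ (f.del1 c) = 0 := LinearMap.congr_fun hmu c
  refine ⟨?_, ?_, ?_, ?_, ?_⟩
  · refine LinearMap.ext fun ⟨c, θ⟩ => ?_
    change T.d (f.lam c + f.del2 θ) - (f.lam (S.d c - S.δ₂ θ) + f.del2 (-S.r θ)) = 0
    simp only [hSr, LinearMap.zero_apply, neg_zero, map_add, map_sub, map_zero]
    linear_combination (norm := abel) hlam c + hdel2 θ
  · refine LinearMap.ext fun ⟨c, θ⟩ => ?_
    change f.del1 (S.d c - S.δ₂ θ) + nu (-S.r θ) + 0 - T.δ₁ (f.lam c + f.del2 θ)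
      - T.r (f.del1 c + nu θ) = 0
    simp only [hSr, hTr, hd1, hd2, LinearMap.zero_apply, neg_zero, map_add, map_sub, map_zero]
    linear_combination (norm := abel) hdel1 c
  · refine LinearMap.ext fun (θ : S.Red.carrier) => ?_
    change T.d (f.mu (S.δ₂ θ) + T.v (f.del2 θ) + T.δ₂ (nu θ)) - T.δ₂ 0
      + (f.lam (S.v (S.δ₂ θ)) + f.del2 (S.δ₁ (S.δ₂ θ)))
      + (f.mu (S.δ₂ (S.r θ)) + T.v (f.del2 (S.r θ)) + T.δ₂ (nu (S.r θ))) = 0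
    have hv := congrArg T.v (hdel2 θ)
    have hvd := hTdv (f.del2 θ)
    have hm := hmu (S.δ₂ θ)
    simp only [hSdδ, hd1, hd2, map_add, map_zero] at hv hvd hm
    simp only [hSr, hTdδ, LinearMap.zero_apply, map_add, map_zero]
    linear_combination (norm := abel) hm + hvd + hv
  · refine LinearMap.ext fun ⟨c, θ⟩ => ?_
    change f.mu (S.d c - S.δ₂ θ) + T.d (f.mu c) + (f.lam (S.v c) + f.del2 (S.δ₁ c))
      - T.v (f.lam c + f.del2 θ) + (f.mu (S.δ₂ θ) + T.v (f.del2 θ) + T.δ₂ (nu θ))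
      - T.δ₂ (f.del1 c + nu θ) = 0
    simp only [map_add, map_sub]
    linear_combination (norm := abel) hmu c
  · simp [lambdaSecond]

theorem lambdaSecond_degreesAt {R : Type u} [CommRing R] {S T : SCData R}
    (hS : S.Degrees) (hT : T.Degrees) {f : SMap S T} {k : ℤ} (hf : f.DegreesAt k)
    {nu : S.Red.carrier →ₗ[R] T.Red.carrier} (hnu : S.Red.IsDeg T.Red (k - 1) nu) :
    (lambdaSecond f nu).DegreesAt (k - 2) := by
  obtain ⟨-, -, -, hSδ₂, -⟩ := hS
  obtain ⟨-, hTv, -, hTδ₂, -⟩ := hT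
  obtain ⟨hlam, hmu, hdel1, hdel2, -⟩ := hf
  refine ⟨?_, ?_, ?_, ?_, ?_⟩
  · rintro i _ ⟨⟨c, θ⟩, ⟨hc, hθ⟩, rfl⟩
    exact add_mem (hlam.apply_mem (by ring) hc) (hdel2.apply_mem (by ring) hθ)
  · rintro i _ ⟨⟨c, θ⟩, ⟨hc, -⟩, rfl⟩
    exact hmu.apply_mem (by ring) hc
  · rintro i _ ⟨⟨c, θ⟩, ⟨hc, hθ⟩, rfl⟩
    exact add_mem (hdel1.apply_mem (by ring) hc) (hnu.apply_mem (by ring) hθ)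
  · rintro i _ ⟨θ, hθ, rfl⟩
    exact add_mem (add_mem (hmu.apply_mem (by ring) (hSδ₂.apply_mem rfl hθ))
      (hTv.apply_mem (by ring) (hdel2.apply_mem rfl hθ)))
      (hTδ₂.apply_mem (by ring) (hnu.apply_mem rfl hθ))
  · rintro i _ ⟨θ, -, rfl⟩
    exact zero_mem _

theorem lambdaSecond_comp_iotaOne {R : Type u} [CommRing R] {S T : SCData R}
    {f : SMap S T} (hrho : f.rho = 0) (nu : S.Red.carrier →ₗ[R] T.Red.carrier) :
    (lambdaSecond f nu).comp (iotaOne S) = f := by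
  obtain ⟨lam, mu, del1, del2, rho⟩ := f
  obtain rfl : rho = 0 := hrho
  rw [SMap.comp, SMap.mk.injEq]
  refine ⟨LinearMap.ext fun c => ?_, LinearMap.ext fun c => ?_, LinearMap.ext fun c => ?_,
    LinearMap.ext fun θ => ?_, LinearMap.zero_comp _⟩
  · change lam c + del2 0 = lam c
    rw [map_zero, add_zero]
  · change lam 0 + del2 0 + mu c + (mu (S.δ₂ 0) + T.v (del2 0) + T.δ₂ (nu 0)) = mu c
    simp only [map_zero, add_zero, zero_add]
  · change del1 c + nu 0 + 0 = del1 c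
    rw [map_zero, add_zero, add_zero]
  · change lam 0 + del2 θ + (mu (S.δ₂ 0) + T.v (del2 0) + T.δ₂ (nu 0)) = del2 θ
    simp only [map_zero, add_zero, zero_add]

/-- For an odd-degree morphism `λ~' : C~' → C~''` between `r`-perfect
`S`-complexes and any map `ν' : 𝖱' → 𝖱''` of degree one less, the block matrix `λ~''`
defines a morphism of `S`-complexes `ΣC~' → C~''` with `λ~'' ∘ ι~₁ = λ~'`. -/
theorem lambdaSecond_isMor {R : Type u} [CommRing R] {S' S'' : SCData R}
    (h1 : S'.IsSComplex) (h1r : S'.RPerfect) (h2 : S''.IsSComplex) (h2r : S''.RPerfect)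
    (f : SMap S' S'') (hf : f.IsMor) (k : ℤ) (hk : Odd k) (hdeg : f.DegreesAt k)
    (hrho : f.rho = 0) (hd2 : S''.δ₁ ∘ₗ f.del2 = 0) (hd1 : f.del1 ∘ₗ S'.δ₂ = 0)
    (nu : S'.Red.carrier →ₗ[R] S''.Red.carrier) (hnu : S'.Red.IsDeg S''.Red (k - 1) nu) :
    (lambdaSecond f nu).IsMor ∧ (lambdaSecond f nu).DegreesAt (k - 2) ∧
    (lambdaSecond f nu).comp (iotaOne S') = f := by
  exact ⟨lambdaSecond_isMor_of_relations h1.2.2.2 h1r.2.1 h2.2.2.2 h2r.2.1 hf hrho hd2 hd1 nu,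
    lambdaSecond_degreesAt h1.2.2.1 h2.2.2.1 hdeg hnu, lambdaSecond_comp_iotaOne hrho nu⟩
end
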